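/- Let m > n and K > 0, suppose (ℝ^n, φ) satisfies the CD(−K, m) condition with ∇φ and ∇²φ uniformly bounded on ℝ^n, and let u : [0,T] × ℝ^n → ℝ be a smooth positive solution of the heat equation ∂ₜu = Lu such that u, ∂ₜu, ∇u and ∇²u are bounded on [0,T] × ℝ^n, and set A := sup{ u(t,x) : (t,x) ∈ [0,T] × ℝ^n } < ∞. Then for all t ∈ (0, T] and x ∈ ℝ^n, ∂ₜu(t,x)/u(t,x) + |∇u(t,x)|²/u(t,x)² ≤ (K/(1 − e^{−Kt})) · [m + 4 log(A/u(t,x))]. (Euclidean case of the paper's Theorem 2.3, Hamilton's estimate for the Witten Laplacian.) -/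

import Mathlib

open scoped RealInnerProductSpace

noncomputable section

/-- Hessian of `f` at `x`, evaluated at the pair of vectors `(v, w)`. -/
def hess (n : ℕ) (f : EuclideanSpace ℝ (Fin n) → ℝ) (x v w : EuclideanSpace ℝ (Fin n)) : ℝ :=
  fderiv ℝ (fun y => fderiv ℝ f y v) x w

/-- Laplacian `Δf = tr ∇²f`. -/
def lap (n : ℕ) (f : EuclideanSpace ℝ (Fin n) → ℝ) (x : EuclideanSpace ℝ (Fin n)) : ℝ :=
  ∑ i : Fin n, hess n f x (EuclideanSpace.single i 1) (EuclideanSpace.single i 1)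

/-- Witten Laplacian `Lf = Δf − ⟨∇φ, ∇f⟩`. -/
def witten (n : ℕ) (φ f : EuclideanSpace ℝ (Fin n) → ℝ) (x : EuclideanSpace ℝ (Fin n)) : ℝ :=
  lap n f x - ⟪gradient φ x, gradient f x⟫

/-- Squared Frobenius norm of the Hessian. -/
def hessNormSq (n : ℕ) (f : EuclideanSpace ℝ (Fin n) → ℝ) (x : EuclideanSpace ℝ (Fin n)) : ℝ :=
  ∑ i : Fin n, ∑ j : Fin n,
    (hess n f x (EuclideanSpace.single i 1) (EuclideanSpace.single j 1)) ^ 2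

/-- The `CD(−K, m)` condition on Euclidean space `ℝⁿ`:
`∇²φ(v,v) − ⟨∇φ, v⟩²/(m−n) ≥ −K|v|²` at every point and for every vector. -/
def CDcond (n : ℕ) (φ : EuclideanSpace ℝ (Fin n) → ℝ) (m K : ℝ) : Prop :=
  ∀ x v : EuclideanSpace ℝ (Fin n),
    hess n φ x v v - ⟪gradient φ x, v⟫ ^ 2 / (m - n) ≥ -K * ‖v‖ ^ 2

open scoped ContDiff

section DirectionalDerivative

variable {P : Type*} [NormedAddCommGroup P] [NormedSpace ℝ P]

/-- Derivative of `f` at `p` in the direction `V`. -/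
def dirDeriv (V : P) (f : P → ℝ) (p : P) : ℝ := fderiv ℝ f p V

variable {f g : P → ℝ} {p : P} {V W : P}

theorem ContDiffAt.dirDeriv (hf : ContDiffAt ℝ ∞ f p) (V : P) :
    ContDiffAt ℝ ∞ (dirDeriv V f) p :=
  (hf.fderiv_right (m := ∞) (by simp)).clm_apply contDiffAt_const

theorem ContDiffAt.eventually_differentiableAt (hf : ContDiffAt ℝ ∞ f p) :
    ∀ᶠ q in nhds p, DifferentiableAt ℝ f q := by
  have h1 : ContDiffAt ℝ 1 f p := hf.of_le (by exact_mod_cast le_top)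
  filter_upwards [h1.eventually (by decide)] with q hq
  exact hq.differentiableAt (by decide)

theorem ContDiffAt.diffAt (hf : ContDiffAt ℝ ∞ f p) : DifferentiableAt ℝ f p :=
  hf.differentiableAt (by decide)

theorem dirDeriv_congr (V : P) (h : f =ᶠ[nhds p] g) : dirDeriv V f =ᶠ[nhds p] dirDeriv V g := by
  filter_upwards [h.fderiv (𝕜 := ℝ)] with q hq
  simp [dirDeriv, hq]

theorem dirDeriv_const (V : P) (c : ℝ) (p : P) : dirDeriv V (fun _ => c) p = 0 := by
  simp [dirDeriv]

theorem dirDeriv_add (hf : DifferentiableAt ℝ f p) (hg : DifferentiableAt ℝ g p) (V : P) :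
    dirDeriv V (fun q => f q + g q) p = dirDeriv V f p + dirDeriv V g p := by
  simp [dirDeriv, fderiv_fun_add hf hg]

theorem dirDeriv_sub (hf : DifferentiableAt ℝ f p) (hg : DifferentiableAt ℝ g p) (V : P) :
    dirDeriv V (fun q => f q - g q) p = dirDeriv V f p - dirDeriv V g p := by
  simp [dirDeriv, fderiv_fun_sub hf hg]

theorem dirDeriv_mul (hf : DifferentiableAt ℝ f p) (hg : DifferentiableAt ℝ g p) (V : P) :
    dirDeriv V (fun q => f q * g q) p = f p * dirDeriv V g p + g p * dirDeriv V f p := by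
  simp [dirDeriv, fderiv_fun_mul hf hg]

theorem dirDeriv_sum {ι : Type*} {s : Finset ι} {F : ι → P → ℝ}
    (hF : ∀ i ∈ s, DifferentiableAt ℝ (F i) p) (V : P) :
    dirDeriv V (fun q => ∑ i ∈ s, F i q) p = ∑ i ∈ s, dirDeriv V (F i) p := by
  simp [dirDeriv, fderiv_fun_sum hF]

theorem dirDeriv_comp {h : ℝ → ℝ} (hh : DifferentiableAt ℝ h (f p)) (hf : DifferentiableAt ℝ f p)
    (V : P) : dirDeriv V (fun q => h (f q)) p = deriv h (f p) * dirDeriv V f p := by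
  have := (hh.hasDerivAt.comp_hasFDerivAt p hf.hasFDerivAt).fderiv
  simp only [Function.comp_def] at this
  simp [dirDeriv, this]

theorem ContDiffAt.two_of_infty (hf : ContDiffAt ℝ ∞ f p) : ContDiffAt ℝ 2 f p :=
  hf.of_le ENat.LEInfty.out

theorem dirDeriv_comm (hf : ContDiffAt ℝ 2 f p) (V W : P) :
    dirDeriv V (dirDeriv W f) p = dirDeriv W (dirDeriv V f) p := by
  have h2 : DifferentiableAt ℝ (fderiv ℝ f) p :=
    (hf.fderiv_right (m := 1) (by norm_num)).differentiableAt (by decide)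
  have key (V W : P) : dirDeriv V (dirDeriv W f) p = fderiv ℝ (fderiv ℝ f) p V W := by
    have : fderiv ℝ (fun q => fderiv ℝ f q W) p = _ :=
      (h2.hasFDerivAt.clm_apply (hasFDerivAt_const W p)).fderiv
    change fderiv ℝ (fun q => fderiv ℝ f q W) p V = _
    simp [this]
  rw [key, key]
  exact (hf.isSymmSndFDerivAt (by simp)).eq V W

end DirectionalDerivative

section HeatOperator

variable {P : Type*} [NormedAddCommGroup P] [NormedSpace ℝ P] {ι : Type*} [Fintype ι]

/-- The parabolic operator `∂_τ - ∑ᵢ ∂ᵢ∂ᵢ + ∑ᵢ aᵢ ∂ᵢ` with time direction `τ`, space directions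
`e i` and drift `a`. -/
def heatOp (τ : P) (e : ι → P) (a : ι → P → ℝ) (f : P → ℝ) (p : P) : ℝ :=
  dirDeriv τ f p - ∑ i, dirDeriv (e i) (dirDeriv (e i) f) p + ∑ i, a i p * dirDeriv (e i) f p

variable {τ : P} {e : ι → P} {a : ι → P → ℝ} {f g : P → ℝ} {p : P}

theorem heatOp_add (hf : ContDiffAt ℝ ∞ f p) (hg : ContDiffAt ℝ ∞ g p) :
    heatOp τ e a (fun q => f q + g q) p = heatOp τ e a f p + heatOp τ e a g p := by
  have h1 (i : ι) : dirDeriv (e i) (fun q => f q + g q) =ᶠ[nhds p]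
      fun q => dirDeriv (e i) f q + dirDeriv (e i) g q := by
    filter_upwards [hf.eventually_differentiableAt, hg.eventually_differentiableAt] with q h h'
    exact dirDeriv_add h h' _
  have h2 (i : ι) : dirDeriv (e i) (dirDeriv (e i) (fun q => f q + g q)) p =
      dirDeriv (e i) (dirDeriv (e i) f) p + dirDeriv (e i) (dirDeriv (e i) g) p := by
    rw [(dirDeriv_congr (e i) (h1 i)).eq_of_nhds]
    exact dirDeriv_add (hf.dirDeriv _).diffAt (hg.dirDeriv _).diffAt _
  simp only [heatOp, h2, dirDeriv_add hf.diffAt hg.diffAt, mul_add, Finset.sum_add_distrib]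
  ring

theorem heatOp_const (c : ℝ) : heatOp τ e a (fun _ => c) p = 0 := by
  have h1 (i : ι) : dirDeriv (e i) (fun _ : P => c) = fun _ => 0 :=
    funext fun q => dirDeriv_const _ _ _
  simp [heatOp, h1, dirDeriv_const]

theorem heatOp_mul (hf : ContDiffAt ℝ ∞ f p) (hg : ContDiffAt ℝ ∞ g p) :
    heatOp τ e a (fun q => f q * g q) p = f p * heatOp τ e a g p + g p * heatOp τ e a f p
      - 2 * ∑ i, dirDeriv (e i) f p * dirDeriv (e i) g p := by
  have h1 (i : ι) : dirDeriv (e i) (fun q => f q * g q) =ᶠ[nhds p]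
      fun q => f q * dirDeriv (e i) g q + g q * dirDeriv (e i) f q := by
    filter_upwards [hf.eventually_differentiableAt, hg.eventually_differentiableAt] with q h h'
    exact dirDeriv_mul h h' _
  have h2 (i : ι) : dirDeriv (e i) (dirDeriv (e i) (fun q => f q * g q)) p =
      f p * dirDeriv (e i) (dirDeriv (e i) g) p + g p * dirDeriv (e i) (dirDeriv (e i) f) p
        + 2 * (dirDeriv (e i) f p * dirDeriv (e i) g p) := by
    rw [(dirDeriv_congr (e i) (h1 i)).eq_of_nhds, dirDeriv_add
      (hf.diffAt.fun_mul (hg.dirDeriv _).diffAt) (hg.diffAt.fun_mul (hf.dirDeriv _).diffAt),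
      dirDeriv_mul hf.diffAt (hg.dirDeriv _).diffAt, dirDeriv_mul hg.diffAt (hf.dirDeriv _).diffAt]
    ring
  have h3 (i : ι) : a i p * dirDeriv (e i) (fun q => f q * g q) p =
      f p * (a i p * dirDeriv (e i) g p) + g p * (a i p * dirDeriv (e i) f p) := by
    rw [dirDeriv_mul hf.diffAt hg.diffAt]
    ring
  simp only [heatOp, h2, h3, Finset.sum_add_distrib, ← Finset.mul_sum]
  rw [dirDeriv_mul hf.diffAt hg.diffAt]
  ring

theorem heatOp_const_mul (c : ℝ) (hf : ContDiffAt ℝ ∞ f p) :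
    heatOp τ e a (fun q => c * f q) p = c * heatOp τ e a f p := by
  rw [heatOp_mul contDiffAt_const hf, heatOp_const]
  simp [dirDeriv_const]

theorem heatOp_sub (hf : ContDiffAt ℝ ∞ f p) (hg : ContDiffAt ℝ ∞ g p) :
    heatOp τ e a (fun q => f q - g q) p = heatOp τ e a f p - heatOp τ e a g p := by
  have := heatOp_add (τ := τ) (e := e) (a := a) hf (contDiffAt_const (c := (-1 : ℝ)).mul hg)
  rw [heatOp_const_mul _ hg] at this
  simp only [neg_one_mul, ← sub_eq_add_neg] at this
  exact this

theorem heatOp_sum {κ : Type*} (s : Finset κ) {F : κ → P → ℝ}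
    (hF : ∀ j, ContDiffAt ℝ ∞ (F j) p) :
    heatOp τ e a (fun q => ∑ j ∈ s, F j q) p = ∑ j ∈ s, heatOp τ e a (F j) p := by
  classical
  induction s using Finset.induction_on with
  | empty => simp [heatOp_const]
  | insert j s hj ih =>
    simp only [Finset.sum_insert hj]
    rw [heatOp_add (hF j) (ContDiffAt.sum fun i _ => hF i), ih]

theorem heatOp_comp {h : ℝ → ℝ} (hh : ContDiffAt ℝ ∞ h (f p)) (hf : ContDiffAt ℝ ∞ f p) :
    heatOp τ e a (fun q => h (f q)) p = deriv h (f p) * heatOp τ e a f p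
      - deriv (deriv h) (f p) * ∑ i, dirDeriv (e i) f p ^ 2 := by
  have hh' : ContDiffAt ℝ ∞ (deriv h) (f p) := hh.dirDeriv 1
  have h1 (i : ι) : dirDeriv (e i) (fun q => h (f q)) =ᶠ[nhds p]
      fun q => deriv h (f q) * dirDeriv (e i) f q := by
    filter_upwards [hf.eventually_differentiableAt,
      hf.continuousAt.eventually hh.eventually_differentiableAt] with q hq hq'
    exact dirDeriv_comp hq' hq _
  have h2 (i : ι) : dirDeriv (e i) (dirDeriv (e i) (fun q => h (f q))) p =
      deriv h (f p) * dirDeriv (e i) (dirDeriv (e i) f) p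
        + deriv (deriv h) (f p) * dirDeriv (e i) f p ^ 2 := by
    rw [(dirDeriv_congr (e i) (h1 i)).eq_of_nhds, dirDeriv_mul
      (DifferentiableAt.fun_comp' p hh'.diffAt hf.diffAt) (hf.dirDeriv _).diffAt,
      dirDeriv_comp hh'.diffAt hf.diffAt]
    ring
  have h3 (i : ι) : a i p * dirDeriv (e i) (fun q => h (f q)) p =
      deriv h (f p) * (a i p * dirDeriv (e i) f p) := by
    rw [dirDeriv_comp hh.diffAt hf.diffAt]
    ring
  simp only [heatOp, h2, h3, Finset.sum_add_distrib, ← Finset.mul_sum]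
  rw [dirDeriv_comp hh.diffAt hf.diffAt]
  ring

theorem dirDeriv_heatOp (ha : ∀ i, ContDiffAt ℝ ∞ (a i) p) (hf : ContDiffAt ℝ ∞ f p) (V : P) :
    dirDeriv V (heatOp τ e a f) p =
      heatOp τ e a (dirDeriv V f) p + ∑ i, dirDeriv V (a i) p * dirDeriv (e i) f p := by
  have d1 : DifferentiableAt ℝ (dirDeriv τ f) p := (hf.dirDeriv _).diffAt
  have d2 (i : ι) : DifferentiableAt ℝ (dirDeriv (e i) (dirDeriv (e i) f)) p :=
    ((hf.dirDeriv _).dirDeriv _).diffAt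
  have d3 (i : ι) : DifferentiableAt ℝ (fun q => a i q * dirDeriv (e i) f q) p :=
    (ha i).diffAt.fun_mul (hf.dirDeriv _).diffAt
  have h2 (i : ι) : dirDeriv V (dirDeriv (e i) (dirDeriv (e i) f)) p =
      dirDeriv (e i) (dirDeriv (e i) (dirDeriv V f)) p := by
    rw [dirDeriv_comm (hf.dirDeriv _).two_of_infty]
    refine (dirDeriv_congr (e i) ?_).eq_of_nhds
    filter_upwards [hf.two_of_infty.eventually (by decide)] with q hq
    exact dirDeriv_comm hq _ _
  unfold heatOp
  rw [dirDeriv_add (d1.fun_sub (DifferentiableAt.fun_sum fun i _ => d2 i))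
    (DifferentiableAt.fun_sum fun i _ => d3 i), dirDeriv_sub d1
    (DifferentiableAt.fun_sum fun i _ => d2 i), dirDeriv_sum fun i _ => d2 i,
    dirDeriv_sum fun i _ => d3 i, dirDeriv_comm hf.two_of_infty]
  simp only [h2, dirDeriv_mul (ha _).diffAt (hf.dirDeriv _).diffAt, Finset.sum_add_distrib,
    dirDeriv_comm hf.two_of_infty V]
  simp only [mul_comm (dirDeriv (e _) f p)]
  ring

end HeatOperator

section SecondDerivative

variable {P : Type*} [NormedAddCommGroup P] [NormedSpace ℝ P] {f : P → ℝ} {p : P}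

theorem hasDerivAt_comp_line (V : P) {r : ℝ} (hf : DifferentiableAt ℝ f (p + r • V)) :
    HasDerivAt (fun s : ℝ => f (p + s • V)) (dirDeriv V f (p + r • V)) r := by
  have h1 : HasDerivAt (fun s : ℝ => p + s • V) V r := by
    simpa using ((hasDerivAt_id r).smul_const V).const_add p
  exact hf.hasFDerivAt.comp_hasDerivAt r h1

theorem dirDeriv_eq_zero_and_nonpos_of_max (hf : ContDiffAt ℝ ∞ f p) (V : P)
    (hmax : ∀ r : ℝ, f (p + r • V) ≤ f p) :
    dirDeriv V f p = 0 ∧ dirDeriv V (dirDeriv V f) p ≤ 0 := by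
  set g : ℝ → ℝ := fun r => f (p + r • V) with hg
  have hline : Filter.Tendsto (fun r : ℝ => p + r • V) (nhds 0) (nhds p) := by
    have : Continuous (fun r : ℝ => p + r • V) := by fun_prop
    simpa using this.tendsto 0
  have h1 : deriv g =ᶠ[nhds 0] fun r => dirDeriv V f (p + r • V) := by
    filter_upwards [hline.eventually hf.eventually_differentiableAt] with r hr
    exact (hasDerivAt_comp_line V hr).deriv
  have h2 : deriv (deriv g) 0 = dirDeriv V (dirDeriv V f) p := by
    rw [h1.deriv_eq]
    have := hasDerivAt_comp_line (p := p) (r := 0) V (by simpa using (hf.dirDeriv V).diffAt)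
    simpa using this.deriv
  have hlm : IsLocalMax g 0 := Filter.Eventually.of_forall fun r => by simpa [hg] using hmax r
  have h3 : dirDeriv V f p = 0 := by
    have := h1.eq_of_nhds
    rw [hlm.deriv_eq_zero] at this
    simpa using this.symm
  refine ⟨h3, ?_⟩
  by_contra! hpos
  have hc : ContinuousAt g 0 := (hasDerivAt_comp_line (p := p) (r := 0) V
    (by simpa using hf.diffAt)).continuousAt
  have hmin := isLocalMin_of_deriv_deriv_pos (by rw [h2]; exact hpos) hlm.deriv_eq_zero hc
  have hconst : g =ᶠ[nhds 0] fun _ => g 0 := by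
    filter_upwards [hmin, hlm] with r h h'
    exact le_antisymm h' h
  have : deriv (deriv g) 0 = 0 := by
    rw [hconst.deriv.deriv_eq]
    simp
  rw [h2] at this
  exact hpos.ne' this

theorem HasDerivAt.nonneg_of_le_left {g : ℝ → ℝ} {g' s t : ℝ} (hg : HasDerivAt g g' t)
    (hst : s < t) (h : ∀ r ∈ Set.Icc s t, g r ≤ g t) : 0 ≤ g' := by
  have h1 := hasDerivWithinAt_iff_tendsto_slope' (by simp) |>.1 (hg.hasDerivWithinAt (s := Set.Iio t))
  refine ge_of_tendsto h1 ?_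
  filter_upwards [Ioo_mem_nhdsLT hst] with r hr
  rw [slope_def_field]
  exact div_nonneg_of_nonpos (by linarith [h r ⟨hr.1.le, hr.2.le⟩]) (by linarith [hr.2])

end SecondDerivative

section MaximumPrinciple

variable {n : ℕ}

/-- The unit vector of `ℝ × ℝⁿ` in the time direction. -/
def timeVec (n : ℕ) : ℝ × EuclideanSpace ℝ (Fin n) := (1, 0)

/-- The unit vector of `ℝ × ℝⁿ` in the `i`-th space direction. -/
def spaceVec (n : ℕ) (i : Fin n) : ℝ × EuclideanSpace ℝ (Fin n) := (0, EuclideanSpace.single i 1)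

variable {a : Fin n → ℝ × EuclideanSpace ℝ (Fin n) → ℝ} {p : ℝ × EuclideanSpace ℝ (Fin n)}

theorem dirDeriv_clm {P : Type*} [NormedAddCommGroup P] [NormedSpace ℝ P] (V : P) (l : P →L[ℝ] ℝ) :
    dirDeriv V l = fun _ => l V := by
  ext q
  simp [dirDeriv]

theorem heatOp_clm {P : Type*} [NormedAddCommGroup P] [NormedSpace ℝ P] {ι : Type*} [Fintype ι]
    (τ : P) (e : ι → P) (a : ι → P → ℝ) (l : P →L[ℝ] ℝ) (p : P) :
    heatOp τ e a l p = l τ + ∑ i, a i p * l (e i) := by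
  simp [heatOp, dirDeriv_clm, dirDeriv_const]

theorem heatOp_fst : heatOp (timeVec n) (spaceVec n) a (fun q => q.1) p = 1 := by
  have := heatOp_clm (timeVec n) (spaceVec n) a (ContinuousLinearMap.fst ℝ _ _) p
  simpa [timeVec, spaceVec] using this

theorem dirDeriv_fst (V : ℝ × EuclideanSpace ℝ (Fin n)) :
    dirDeriv V (fun q => q.1) p = V.1 :=
  congrFun (dirDeriv_clm V (ContinuousLinearMap.fst ℝ _ _)) p

/-- A function of time only is differentiated by the heat operator as by `d/dt`. -/
theorem heatOp_comp_fst {h : ℝ → ℝ} (hh : ContDiffAt ℝ ∞ h p.1) :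
    heatOp (timeVec n) (spaceVec n) a (fun q => h q.1) p = deriv h p.1 := by
  rw [heatOp_comp hh contDiffAt_fst, heatOp_fst]
  simp [dirDeriv_fst, spaceVec]

theorem heatOp_comp_fst_mul {h : ℝ → ℝ} {f : ℝ × EuclideanSpace ℝ (Fin n) → ℝ}
    (hh : ContDiffAt ℝ ∞ h p.1) (hf : ContDiffAt ℝ ∞ f p) :
    heatOp (timeVec n) (spaceVec n) a (fun q => h q.1 * f q) p =
      h p.1 * heatOp (timeVec n) (spaceVec n) a f p + deriv h p.1 * f p := by
  have h0 (i : Fin n) : dirDeriv (spaceVec n i) (fun q => h q.1) p = 0 := by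
    rw [dirDeriv_comp hh.diffAt differentiableAt_fst, dirDeriv_fst]
    simp [spaceVec]
  rw [heatOp_mul (f := fun q => h q.1) (hh.comp p contDiffAt_fst) hf, heatOp_comp_fst hh]
  simp only [h0]
  simp
  ring

theorem contDiff_normSq_snd :
    ContDiff ℝ ∞ (fun q : ℝ × EuclideanSpace ℝ (Fin n) => 1 + ∑ i, q.2 i * q.2 i) := by
  fun_prop

theorem heatOp_normSq_snd :
    heatOp (timeVec n) (spaceVec n) a (fun q => 1 + ∑ i, q.2 i * q.2 i) p =
      2 * ∑ i, a i p * p.2 i - 2 * n := by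
  have hc (i : Fin n) : ContDiff ℝ ∞ (fun q : ℝ × EuclideanSpace ℝ (Fin n) => q.2 i) := by
    fun_prop
  have hl (i : Fin n) : (fun q : ℝ × EuclideanSpace ℝ (Fin n) => q.2 i) =
      ((EuclideanSpace.proj i : EuclideanSpace ℝ (Fin n) →L[ℝ] ℝ).comp
        (ContinuousLinearMap.snd ℝ ℝ (EuclideanSpace ℝ (Fin n)))) := by
    ext q; simp
  have hd (i j : Fin n) : dirDeriv (spaceVec n j)
      (fun q : ℝ × EuclideanSpace ℝ (Fin n) => q.2 i) p = if i = j then 1 else 0 := by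
    rw [hl, dirDeriv_clm]
    simp [spaceVec]
  have hh (i : Fin n) : heatOp (timeVec n) (spaceVec n) a (fun q => q.2 i) p = a i p := by
    rw [hl, heatOp_clm]
    simp [spaceVec, timeVec]
  have hm (i : Fin n) : heatOp (timeVec n) (spaceVec n) a (fun q => q.2 i * q.2 i) p =
      2 * (a i p * p.2 i) - 2 := by
    rw [heatOp_mul (hc i).contDiffAt (hc i).contDiffAt, hh]
    simp [hd]
    ring
  rw [heatOp_add contDiffAt_const (by fun_prop), heatOp_const,
    heatOp_sum (F := fun i (q : ℝ × EuclideanSpace ℝ (Fin n)) => q.2 i * q.2 i) Finset.univ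
      fun i => ((hc i).mul (hc i)).contDiffAt]
  simp only [hm, Finset.sum_sub_distrib, ← Finset.mul_sum]
  simp
  ring

/-- Weak maximum principle on `[s, t] × ℝⁿ` for functions bounded above. -/
theorem le_zero_of_heatOp_nonpos {B : ℝ} (ha : ∀ i q, |a i q| ≤ B)
    {f : ℝ × EuclideanSpace ℝ (Fin n) → ℝ} {s t M : ℝ}
    (hf : ∀ q, q.1 ∈ Set.Icc s t → ContDiffAt ℝ ∞ f q)
    (hM : ∀ q, q.1 ∈ Set.Icc s t → f q ≤ M) (h0 : ∀ x, f (s, x) ≤ 0)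
    (hheat : ∀ q, q.1 ∈ Set.Ioc s t → 0 < f q → heatOp (timeVec n) (spaceVec n) a f q ≤ 0)
    (q : ℝ × EuclideanSpace ℝ (Fin n)) (hq : q.1 ∈ Set.Icc s t) : f q ≤ 0 := by
  by_contra! hpos
  set N : ℝ × EuclideanSpace ℝ (Fin n) → ℝ := fun q => 1 + ∑ i, q.2 i * q.2 i with hN
  have hNnorm (q) : N q = 1 + ‖q.2‖ ^ 2 := by
    rw [EuclideanSpace.norm_sq_eq]
    simp [hN, sq]
  set C : ℝ := n * B ^ 2 + 2 * n + 2 with hC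
  have hC0 : 0 ≤ C := by positivity
  set b : ℝ × EuclideanSpace ℝ (Fin n) → ℝ := fun q => Real.exp (C * q.1) * N q with hb
  have hN1 (q) : 1 ≤ N q := by rw [hNnorm]; nlinarith [sq_nonneg ‖q.2‖]
  have hb0 (q) : 0 < b q := mul_pos (Real.exp_pos _) (by linarith [hN1 q])
  have hexp : ContDiff ℝ ∞ fun r : ℝ => Real.exp (C * r) := by fun_prop
  have hNs : ContDiff ℝ ∞ N := contDiff_normSq_snd
  have hbs : ContDiff ℝ ∞ b := (hexp.comp contDiff_fst).mul hNs
  have hbheat (q) : 0 < heatOp (timeVec n) (spaceVec n) a b q := by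
    have hd : deriv (fun r : ℝ => Real.exp (C * r)) q.1 = Real.exp (C * q.1) * C := by
      have := ((hasDerivAt_id q.1).const_mul C).exp.deriv
      simpa using this
    have hle : -(n * B ^ 2) - (N q - 1) ≤ 2 * ∑ i, a i q * q.2 i := by
      have : ∑ i : Fin n, (-(B ^ 2) - q.2 i * q.2 i) ≤ ∑ i, 2 * (a i q * q.2 i) := by
        refine Finset.sum_le_sum fun i _ => ?_
        have := sq_le_sq' (by linarith [neg_abs_le (a i q), ha i q]) ((le_abs_self _).trans (ha i q))
        nlinarith [sq_nonneg (a i q + q.2 i)]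
      rw [Finset.sum_sub_distrib, ← Finset.mul_sum] at this
      simp at this
      simp only [hN]
      linarith
    rw [hb, heatOp_comp_fst_mul hexp.contDiffAt hNs.contDiffAt, hd, heatOp_normSq_snd]
    have : 0 < (2 * ∑ i, a i q * q.2 i - 2 * n) + C * N q := by
      have : 0 ≤ (n * B ^ 2 + 2 * n : ℝ) := by positivity
      rw [hC]
      nlinarith [hN1 q]
    have := mul_pos (Real.exp_pos (C * q.1)) this
    linarith
  set ε : ℝ := f q / (2 * b q) with hε
  have hε0 : 0 < ε := div_pos hpos (by linarith [hb0 q])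
  have hεb : ε * b q = f q / 2 := by
    rw [hε]; field_simp [(hb0 q).ne']
  set G : ℝ × EuclideanSpace ℝ (Fin n) → ℝ := fun q => f q - ε * b q with hG
  have hGq : 0 < G q := by simp only [hG, hεb]; linarith
  have hGs (q) (hq : q.1 ∈ Set.Icc s t) : ContDiffAt ℝ ∞ G q :=
    (hf q hq).sub (contDiffAt_const.mul hbs.contDiffAt)
  have hM0 : 0 < M := hpos.trans_le (hM q hq)
  set c : ℝ := ε * Real.exp (C * s) with hc
  have hc0 : 0 < c := mul_pos hε0 (Real.exp_pos _)
  set R : ℝ := 1 + M / c with hR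
  have hR1 : 1 ≤ R := by have := div_pos hM0 hc0; linarith
  have hball (y : ℝ × EuclideanSpace ℝ (Fin n)) (hy : y.1 ∈ Set.Icc s t) (hGy : 0 < G y) :
      y ∈ Set.Icc s t ×ˢ Metric.closedBall (0 : EuclideanSpace ℝ (Fin n)) R := by
    refine ⟨hy, ?_⟩
    rw [mem_closedBall_zero_iff]
    by_contra! hRy
    have h1 : Real.exp (C * s) ≤ Real.exp (C * y.1) :=
      Real.exp_le_exp.2 (mul_le_mul_of_nonneg_left hy.1 hC0)
    have h2 : R ≤ N y := by rw [hNnorm]; nlinarith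
    have h3 : c * R ≤ ε * b y := by
      rw [hc, mul_assoc]
      change _ ≤ ε * (Real.exp (C * y.1) * N y)
      gcongr
    have h4 : c * R = c + M := by rw [hR]; field_simp
    have h5 := hM y hy
    simp only [hG] at hGy
    linarith
  obtain ⟨z, hz, hmax⟩ := (isCompact_Icc.prod (isCompact_closedBall
      (0 : EuclideanSpace ℝ (Fin n)) R)).exists_isMaxOn ⟨q, hball q hq hGq⟩
    (f := G) (fun y hy => (hGs y hy.1).continuousAt.continuousWithinAt)
  have hGz : 0 < G z := hGq.trans_le (hmax (hball q hq hGq))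
  have hmax' (y : ℝ × EuclideanSpace ℝ (Fin n)) (hy : y.1 ∈ Set.Icc s t) : G y ≤ G z := by
    by_cases h : 0 < G y
    · exact hmax (hball y hy h)
    · linarith
  have hzt : z.1 ∈ Set.Icc s t := hz.1
  have hfz : 0 < f z := by
    have := mul_pos hε0 (hb0 z)
    simp only [hG] at hGz
    linarith
  have hsz : s < z.1 := by
    refine lt_of_le_of_ne hzt.1 fun h => ?_
    have := h0 z.2
    rw [h] at this
    exact absurd hfz (not_lt.2 this)
  have hspace (i : Fin n) := dirDeriv_eq_zero_and_nonpos_of_max (hGs z hzt) (spaceVec n i)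
    fun r => hmax' _ (by simpa [spaceVec] using hzt)
  have htime : 0 ≤ dirDeriv (timeVec n) G z := by
    have h1 := hasDerivAt_comp_line (p := z - z.1 • timeVec n) (r := z.1) (timeVec n) (f := G)
      (by simpa using (hGs z hzt).diffAt)
    rw [sub_add_cancel] at h1
    refine h1.nonneg_of_le_left hsz fun r hr => ?_
    rw [sub_add_cancel]
    exact hmax' _ (by simpa [timeVec] using ⟨hr.1, hr.2.trans hzt.2⟩)
  have hGheat : 0 ≤ heatOp (timeVec n) (spaceVec n) a G z := by
    have := Finset.sum_nonpos fun i (_ : i ∈ Finset.univ) => (hspace i).2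
    simp only [heatOp, (hspace _).1, mul_zero, Finset.sum_const_zero, add_zero]
    linarith
  rw [hG, heatOp_sub (hf z hzt) (contDiffAt_const.mul hbs.contDiffAt),
    heatOp_const_mul _ hbs.contDiffAt] at hGheat
  linarith [hheat z ⟨hsz, hzt.2⟩ hfz, mul_pos hε0 (hbheat z)]

end MaximumPrinciple

section Bochner

variable {P : Type*} [NormedAddCommGroup P] [NormedSpace ℝ P] {ι : Type*} [Fintype ι]
  {τ : P} {e : ι → P} {a : ι → P → ℝ} {F : P → ℝ} {p : P}

/-- Squared length of the spatial gradient. -/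
def gradSq (e : ι → P) (F : P → ℝ) (p : P) : ℝ := ∑ j, dirDeriv (e j) F p * dirDeriv (e j) F p

theorem gradSq_nonneg (e : ι → P) (F : P → ℝ) (p : P) : 0 ≤ gradSq e F p :=
  Finset.sum_nonneg fun _ _ => mul_self_nonneg _

theorem ContDiffAt.gradSq (hF : ContDiffAt ℝ ∞ F p) : ContDiffAt ℝ ∞ (gradSq e F) p :=
  ContDiffAt.sum fun j _ => (hF.dirDeriv (e j)).mul (hF.dirDeriv (e j))

theorem heatOp_dirDeriv (ha : ∀ i, ContDiffAt ℝ ∞ (a i) p) (hF : ContDiffAt ℝ ∞ F p)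
    (hheat : heatOp τ e a F =ᶠ[nhds p] fun _ => 0) (V : P) :
    heatOp τ e a (dirDeriv V F) p = -∑ i, dirDeriv V (a i) p * dirDeriv (e i) F p := by
  have h := dirDeriv_heatOp (τ := τ) (e := e) ha hF V
  rw [(dirDeriv_congr V hheat).eq_of_nhds, dirDeriv_const] at h
  linarith

theorem heatOp_gradSq (ha : ∀ i, ContDiffAt ℝ ∞ (a i) p) (hF : ContDiffAt ℝ ∞ F p)
    (hheat : heatOp τ e a F =ᶠ[nhds p] fun _ => 0) :
    heatOp τ e a (gradSq e F) p =
      -2 * (∑ i, ∑ j, dirDeriv (e i) (dirDeriv (e j) F) p ^ 2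
        + ∑ i, ∑ j, dirDeriv (e i) F p * dirDeriv (e j) F p * dirDeriv (e j) (a i) p) := by
  have h1 (j : ι) : heatOp τ e a (fun q => dirDeriv (e j) F q * dirDeriv (e j) F q) p =
      -2 * (∑ i, dirDeriv (e i) (dirDeriv (e j) F) p ^ 2
        + ∑ i, dirDeriv (e i) F p * dirDeriv (e j) F p * dirDeriv (e j) (a i) p) := by
    rw [heatOp_mul (hF.dirDeriv _) (hF.dirDeriv _), heatOp_dirDeriv ha hF hheat]
    simp only [mul_add, mul_neg, Finset.mul_sum, ← Finset.sum_neg_distrib,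
      ← Finset.sum_add_distrib, ← Finset.sum_sub_distrib]
    exact Finset.sum_congr rfl fun i _ => by ring
  unfold gradSq
  rw [heatOp_sum (F := fun j q => dirDeriv (e j) F q * dirDeriv (e j) F q) _
    fun j => (hF.dirDeriv _).mul (hF.dirDeriv _)]
  simp only [h1, ← Finset.mul_sum, Finset.sum_add_distrib]
  rw [Finset.sum_comm (f := fun i j => dirDeriv (e i) (dirDeriv (e j) F) p ^ 2),
    Finset.sum_comm (f := fun i j => dirDeriv (e i) F p * dirDeriv (e j) F p * _)]

theorem dirDeriv_gradSq (hF : ContDiffAt ℝ ∞ F p) (V : P) :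
    dirDeriv V (gradSq e F) p = 2 * ∑ j, dirDeriv (e j) F p * dirDeriv V (dirDeriv (e j) F) p := by
  unfold gradSq
  rw [dirDeriv_sum fun j _ => (hF.dirDeriv _).diffAt.fun_mul (hF.dirDeriv _).diffAt,
    Finset.mul_sum]
  refine Finset.sum_congr rfl fun j _ => ?_
  rw [dirDeriv_mul (hF.dirDeriv _).diffAt (hF.dirDeriv _).diffAt]
  ring

theorem deriv_deriv_inv (y : ℝ) (hy : y ≠ 0) : deriv (deriv fun x : ℝ => x⁻¹) y = 2 / y ^ 3 := by
  rw [deriv_inv']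
  have := (((hasDerivAt_id y).pow 2).inv (pow_ne_zero 2 hy)).neg.deriv
  refine Eq.trans (by rfl) (this.trans ?_)
  simp
  field_simp

theorem heatOp_gradSq_div (ha : ∀ i, ContDiffAt ℝ ∞ (a i) p) (hF : ContDiffAt ℝ ∞ F p)
    (hheat : heatOp τ e a F =ᶠ[nhds p] fun _ => 0) (hpos : F p ≠ 0) :
    heatOp τ e a (fun q => gradSq e F q * (F q)⁻¹) p =
      -(2 / F p) * (∑ i, ∑ j, (dirDeriv (e i) (dirDeriv (e j) F) p
          - dirDeriv (e i) F p * dirDeriv (e j) F p / F p) ^ 2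
        + ∑ i, ∑ j, dirDeriv (e i) F p * dirDeriv (e j) F p * dirDeriv (e j) (a i) p) := by
  have hinv : ContDiffAt ℝ ∞ (fun x : ℝ => x⁻¹) (F p) := contDiffAt_inv ℝ hpos
  have hd (i : ι) : dirDeriv (e i) (fun q => (F q)⁻¹) p = -(F p ^ 2)⁻¹ * dirDeriv (e i) F p := by
    rw [dirDeriv_comp (h := fun x => x⁻¹) hinv.diffAt hF.diffAt, deriv_inv]
  have h2 : heatOp τ e a (fun q => (F q)⁻¹) p = -(2 / F p ^ 3) * gradSq e F p := by
    rw [heatOp_comp (h := fun x => x⁻¹) hinv hF, hheat.eq_of_nhds, deriv_deriv_inv _ hpos]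
    simp [gradSq, sq]
  have h3 : gradSq e F p * gradSq e F p =
      ∑ i, ∑ j, (dirDeriv (e i) F p * dirDeriv (e j) F p) ^ 2 := by
    simp only [gradSq, Finset.sum_mul_sum]
    exact Finset.sum_congr rfl fun i _ => Finset.sum_congr rfl fun j _ => by ring
  have h4 : ∑ i, ∑ j, (dirDeriv (e i) (dirDeriv (e j) F) p
          - dirDeriv (e i) F p * dirDeriv (e j) F p / F p) ^ 2 =
      ∑ i, ∑ j, dirDeriv (e i) (dirDeriv (e j) F) p ^ 2
      - 2 / F p * ∑ i, ∑ j, dirDeriv (e i) F p * dirDeriv (e j) F p *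
          dirDeriv (e i) (dirDeriv (e j) F) p
      + (F p ^ 2)⁻¹ * (gradSq e F p * gradSq e F p) := by
    rw [h3]
    simp only [Finset.mul_sum, ← Finset.sum_sub_distrib, ← Finset.sum_add_distrib]
    refine Finset.sum_congr rfl fun i _ => Finset.sum_congr rfl fun j _ => ?_
    field_simp
    ring
  have h5 : ∑ i, dirDeriv (e i) (gradSq e F) p * dirDeriv (e i) (fun q => (F q)⁻¹) p =
      -(2 * (F p ^ 2)⁻¹) * ∑ i, ∑ j, dirDeriv (e i) F p * dirDeriv (e j) F p *
          dirDeriv (e i) (dirDeriv (e j) F) p := by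
    simp only [hd, dirDeriv_gradSq hF, Finset.mul_sum, Finset.sum_mul]
    refine Finset.sum_congr rfl fun i _ => Finset.sum_congr rfl fun j _ => ?_
    ring
  rw [heatOp_mul (g := fun q => (F q)⁻¹) hF.gradSq (hinv.comp p hF), h2,
    heatOp_gradSq ha hF hheat, h4, h5]
  field_simp
  ring

end Bochner

section Hamilton

theorem hamilton_scalar_ineq {m f K ψ p w : ℝ} (hm : 0 < m) (hf : 0 < f) (hK : 0 < K)
    (hψ : 0 ≤ ψ) (hψ1 : K * ψ ≤ 1) (hp : 0 ≤ p) (h : m * f ≤ ψ * (w + p)) :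
    ψ * (-(2 / (m * f)) * (w - p) ^ 2 + 2 * K * p) + (1 - K * ψ) * (w + p) - 4 * p ≤ 0 := by
  have hmf : 0 < m * f := mul_pos hm hf
  have hKψp : 0 ≤ K * ψ * p := by positivity
  rcases le_total w (3 * p) with hw | hw
  · have h1 : 0 ≤ ψ * (2 / (m * f)) * (w - p) ^ 2 := by positivity
    nlinarith [mul_nonneg (sub_nonneg.2 hψ1) (sub_nonneg.2 hw)]
  · have hs : 0 < w + p := by
      by_contra! hs
      nlinarith
    have h1 : 1 / (w + p) ≤ ψ / (m * f) := by
      rw [div_le_div_iff₀ hs hmf]; linarith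
    have h2 : 2 * (w - 3 * p) ≤ ψ * (2 / (m * f)) * (w - p) ^ 2 := by
      have h3 : 2 * (w - 3 * p) ≤ 2 * (1 / (w + p)) * (w - p) ^ 2 := by
        rw [show 2 * (1 / (w + p)) * (w - p) ^ 2 = 2 * (w - p) ^ 2 / (w + p) by ring,
          le_div_iff₀ hs]
        nlinarith [sq_nonneg p]
      calc _ ≤ _ := h3
        _ ≤ 2 * (ψ / (m * f)) * (w - p) ^ 2 := by gcongr
        _ = _ := by ring
    nlinarith [mul_nonneg (mul_nonneg hK.le hψ) (sub_nonneg.2 hw)]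

/-- The trace inequality behind the curvature-dimension condition: if `(x + b)² ≤ n S`, then
`S ≥ x² / m - b² / (m - n)`. -/
theorem sq_div_le_of_trace {n m x b S : ℝ} (hn : 0 < n) (hm : n < m) (h : (x + b) ^ 2 ≤ n * S) :
    x ^ 2 / m - b ^ 2 / (m - n) ≤ S := by
  have h1 : x ^ 2 / m - b ^ 2 / (m - n) ≤ (x + b) ^ 2 / n := by
    have : (x + b) ^ 2 / n - (x ^ 2 / m - b ^ 2 / (m - n)) =
        ((m - n) * x + m * b) ^ 2 / (n * m * (m - n)) := by
      have h1 : m ≠ 0 := by linarith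
      have h2 : m - n ≠ 0 := by linarith
      field_simp
      ring
    have h3 : 0 ≤ ((m - n) * x + m * b) ^ 2 / (n * m * (m - n)) := by
      have : 0 < n * m * (m - n) := by
        have : 0 < m - n := by linarith
        have : 0 < m := by linarith
        positivity
      positivity
    linarith
  refine h1.trans ?_
  rw [div_le_iff₀ hn]
  linarith

variable {n : ℕ} {a : Fin n → ℝ × EuclideanSpace ℝ (Fin n) → ℝ}
  {F : ℝ × EuclideanSpace ℝ (Fin n) → ℝ} {p : ℝ × EuclideanSpace ℝ (Fin n)} {m K : ℝ}

theorem heatOp_gradSq_div_le (hn : 1 ≤ n) (hm : (n : ℝ) < m)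
    (hCD : ∀ v : Fin n → ℝ, -K * ∑ i, v i * v i ≤
      ∑ i, ∑ j, v i * v j * dirDeriv (spaceVec n j) (a i) p - (∑ i, a i p * v i) ^ 2 / (m - n))
    (ha : ∀ i, ContDiffAt ℝ ∞ (a i) p) (hF : ContDiffAt ℝ ∞ F p)
    (hheat : heatOp (timeVec n) (spaceVec n) a F =ᶠ[nhds p] fun _ => 0) (hpos : 0 < F p) :
    heatOp (timeVec n) (spaceVec n) a (fun q => gradSq (spaceVec n) F q * (F q)⁻¹) p ≤
      -(2 / (m * F p)) * (dirDeriv (timeVec n) F p - gradSq (spaceVec n) F p * (F p)⁻¹) ^ 2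
        + 2 * K * (gradSq (spaceVec n) F p * (F p)⁻¹) := by
  have hn0 : (0 : ℝ) < n := by exact_mod_cast hn
  set g : Fin n → ℝ := fun i => dirDeriv (spaceVec n i) F p with hg
  set S := ∑ i, ∑ j, (dirDeriv (spaceVec n i) (dirDeriv (spaceVec n j) F) p
    - g i * g j / F p) ^ 2 with hS
  have htr : ∑ i, (dirDeriv (spaceVec n i) (dirDeriv (spaceVec n i) F) p - g i * g i / F p) =
      (dirDeriv (timeVec n) F p - gradSq (spaceVec n) F p * (F p)⁻¹) + ∑ i, a i p * g i := by
    have h0 := hheat.eq_of_nhds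
    simp only [heatOp] at h0
    simp only [Finset.sum_sub_distrib, Finset.sum_mul, gradSq, hg, div_eq_mul_inv]
    linarith
  have hcs : ((dirDeriv (timeVec n) F p - gradSq (spaceVec n) F p * (F p)⁻¹)
      + ∑ i, a i p * g i) ^ 2 ≤ n * S := by
    rw [← htr]
    refine sq_sum_le_card_mul_sum_sq.trans ?_
    simp only [Finset.card_univ, Fintype.card_fin]
    refine mul_le_mul_of_nonneg_left (Finset.sum_le_sum fun i _ => ?_) hn0.le
    exact Finset.single_le_sum (f := fun j => (dirDeriv (spaceVec n i)
      (dirDeriv (spaceVec n j) F) p - g i * g j / F p) ^ 2) (fun j _ => sq_nonneg _)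
      (Finset.mem_univ i)
  have h1 := sq_div_le_of_trace hn0 hm hcs
  have h2 := hCD g
  rw [heatOp_gradSq_div ha hF hheat hpos.ne']
  have h3 : (dirDeriv (timeVec n) F p - gradSq (spaceVec n) F p * (F p)⁻¹) ^ 2 / m
      - K * gradSq (spaceVec n) F p ≤ S + ∑ i, ∑ j, g i * g j * dirDeriv (spaceVec n j) (a i) p := by
    have : gradSq (spaceVec n) F p = ∑ i, g i * g i := rfl
    rw [← this] at h2
    linarith
  have h4 := mul_le_mul_of_nonneg_left h3 (div_nonneg zero_le_two hpos.le)
  have h5 : 2 / F p * ((dirDeriv (timeVec n) F p - gradSq (spaceVec n) F p * (F p)⁻¹) ^ 2 / m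
      - K * gradSq (spaceVec n) F p) =
      2 / (m * F p) * (dirDeriv (timeVec n) F p - gradSq (spaceVec n) F p * (F p)⁻¹) ^ 2
        - 2 * K * (gradSq (spaceVec n) F p * (F p)⁻¹) := by
    have : m ≠ 0 := by linarith
    field_simp
  linarith

/-- Hamilton's quantity, with time origin `s` and `c` playing the role of `log (sup F)`. -/
def hamiltonQuantity (n : ℕ) (m K s c : ℝ) (F : ℝ × EuclideanSpace ℝ (Fin n) → ℝ)
    (q : ℝ × EuclideanSpace ℝ (Fin n)) : ℝ :=
  (1 - Real.exp (-K * (q.1 - s))) / K *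
      (dirDeriv (timeVec n) F q + gradSq (spaceVec n) F q * (F q)⁻¹)
    - ((m + 4 * c) * F q - 4 * (F q * Real.log (F q)))

theorem contDiffAt_hamiltonQuantity {s c : ℝ} (hF : ContDiffAt ℝ ∞ F p) (hpos : 0 < F p) :
    ContDiffAt ℝ ∞ (hamiltonQuantity n m K s c F) p := by
  have h1 := hF.dirDeriv (timeVec n)
  have h2 : ContDiffAt ℝ ∞ (gradSq (spaceVec n) F) p := hF.gradSq
  have h3 := hF.inv hpos.ne'
  have h4 := hF.log hpos.ne'
  have h5 : ContDiff ℝ ∞ fun q : ℝ × EuclideanSpace ℝ (Fin n) =>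
      (1 - Real.exp (-K * (q.1 - s))) / K := by fun_prop
  exact (h5.contDiffAt.mul (h1.add (h2.mul h3))).sub
    ((contDiffAt_const.mul hF).sub (contDiffAt_const.mul (hF.mul h4)))

theorem heatOp_hamiltonQuantity_nonpos {s c : ℝ} (hK : 0 < K) (hn : 1 ≤ n) (hm : (n : ℝ) < m)
    (hCD : ∀ v : Fin n → ℝ, -K * ∑ i, v i * v i ≤
      ∑ i, ∑ j, v i * v j * dirDeriv (spaceVec n j) (a i) p - (∑ i, a i p * v i) ^ 2 / (m - n))
    (ha : ∀ i, ContDiffAt ℝ ∞ (a i) p) (ha' : ∀ i, dirDeriv (timeVec n) (a i) p = 0)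
    (hF : ContDiffAt ℝ ∞ F p)
    (hheat : heatOp (timeVec n) (spaceVec n) a F =ᶠ[nhds p] fun _ => 0) (hpos : 0 < F p)
    (hs : s ≤ p.1) (hc : Real.log (F p) ≤ c) (hQ : 0 < hamiltonQuantity n m K s c F p) :
    heatOp (timeVec n) (spaceVec n) a (hamiltonQuantity n m K s c F) p ≤ 0 := by
  have hm0 : 0 < m := lt_of_le_of_lt (Nat.cast_nonneg n) hm
  have h1 := hF.dirDeriv (timeVec n)
  have h2 : ContDiffAt ℝ ∞ (gradSq (spaceVec n) F) p := hF.gradSq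
  have h3 := hF.inv hpos.ne'
  have hψ : ContDiff ℝ ∞ fun r : ℝ => (1 - Real.exp (-K * (r - s))) / K := by fun_prop
  have hψd : deriv (fun r : ℝ => (1 - Real.exp (-K * (r - s))) / K) p.1 =
      1 - K * ((1 - Real.exp (-K * (p.1 - s))) / K) := by
    have := (((((hasDerivAt_id p.1).sub_const s).const_mul (-K)).exp.const_sub 1).div_const K).deriv
    simp only [id] at this
    rw [this]
    field_simp
    ring
  have hh : ContDiffAt ℝ ∞ (fun y : ℝ => (m + 4 * c) * y - 4 * (y * Real.log y)) (F p) := by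
    have := Real.contDiffAt_log (n := ∞).2 hpos.ne'
    fun_prop
  have hd1 : deriv (fun y : ℝ => (m + 4 * c) * y - 4 * (y * Real.log y)) =ᶠ[nhds (F p)]
      fun y => m + 4 * c - 4 * (Real.log y + 1) := by
    filter_upwards [lt_mem_nhds hpos] with y hy
    have := (((hasDerivAt_id y).const_mul (m + 4 * c)).sub
      ((Real.hasDerivAt_mul_log hy.ne').const_mul 4)).deriv
    simp only [mul_one] at this
    exact this
  have hd2 : deriv (deriv fun y : ℝ => (m + 4 * c) * y - 4 * (y * Real.log y)) (F p) =
      -(4 * (F p)⁻¹) := by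
    rw [hd1.deriv_eq]
    simp
  have hw : heatOp (timeVec n) (spaceVec n) a (dirDeriv (timeVec n) F) p = 0 := by
    rw [heatOp_dirDeriv ha hF hheat]
    simp [ha']
  have hle := heatOp_gradSq_div_le hn hm hCD ha hF hheat hpos
  have hψ0 : 0 ≤ (1 - Real.exp (-K * (p.1 - s))) / K := by
    refine div_nonneg (sub_nonneg.2 (Real.exp_le_one_iff.2 ?_)) hK.le
    nlinarith
  have hψ1 : K * ((1 - Real.exp (-K * (p.1 - s))) / K) ≤ 1 := by
    rw [mul_div_cancel₀ _ hK.ne']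
    linarith [Real.exp_pos (-K * (p.1 - s))]
  have hp0 : 0 ≤ gradSq (spaceVec n) F p * (F p)⁻¹ :=
    mul_nonneg (gradSq_nonneg _ _ _) (inv_nonneg.2 hpos.le)
  have hmF : m * F p ≤ (1 - Real.exp (-K * (p.1 - s))) / K *
      (dirDeriv (timeVec n) F p + gradSq (spaceVec n) F p * (F p)⁻¹) := by
    unfold hamiltonQuantity at hQ
    nlinarith [mul_nonneg hpos.le (sub_nonneg.2 hc)]
  have key := hamilton_scalar_ineq hm0 hpos hK hψ0 hψ1 hp0 hmF
  have heq : heatOp (timeVec n) (spaceVec n) a (hamiltonQuantity n m K s c F) p =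
      (1 - Real.exp (-K * (p.1 - s))) / K *
        heatOp (timeVec n) (spaceVec n) a (fun q => gradSq (spaceVec n) F q * (F q)⁻¹) p
      + (1 - K * ((1 - Real.exp (-K * (p.1 - s))) / K)) *
        (dirDeriv (timeVec n) F p + gradSq (spaceVec n) F p * (F p)⁻¹)
      - 4 * (gradSq (spaceVec n) F p * (F p)⁻¹) := by
    have hgs : ∑ i, dirDeriv (spaceVec n i) F p ^ 2 = gradSq (spaceVec n) F p := by
      simp [gradSq, sq]
    unfold hamiltonQuantity
    rw [heatOp_sub
      (f := fun q => (1 - Real.exp (-K * (q.1 - s))) / K *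
        (dirDeriv (timeVec n) F q + gradSq (spaceVec n) F q * (F q)⁻¹))
      (g := fun q => (m + 4 * c) * F q - 4 * (F q * Real.log (F q)))
      ((hψ.contDiffAt.comp p contDiffAt_fst).mul (h1.add (h2.mul h3))) (hh.comp p hF),
      heatOp_comp_fst_mul (h := fun r => (1 - Real.exp (-K * (r - s))) / K)
        (f := fun q => dirDeriv (timeVec n) F q + gradSq (spaceVec n) F q * (F q)⁻¹)
        hψ.contDiffAt (h1.add (h2.mul h3)), hψd,
      heatOp_add (g := fun q => gradSq (spaceVec n) F q * (F q)⁻¹) h1 (h2.mul h3), hw,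
      heatOp_comp (h := fun y => (m + 4 * c) * y - 4 * (y * Real.log y)) hh hF, hd2,
      hheat.eq_of_nhds, hgs]
    ring
  rw [heq]
  linarith [mul_le_mul_of_nonneg_left hle hψ0]

end Hamilton

section Translation

variable {n : ℕ}

theorem gradient_apply (f : EuclideanSpace ℝ (Fin n) → ℝ) (x : EuclideanSpace ℝ (Fin n))
    (i : Fin n) : gradient f x i = fderiv ℝ f x (EuclideanSpace.single i 1) := by
  rw [← inner_gradient_left, EuclideanSpace.inner_single_right]
  simp

theorem norm_gradient_sq (f : EuclideanSpace ℝ (Fin n) → ℝ) (x : EuclideanSpace ℝ (Fin n)) :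
    ‖gradient f x‖ ^ 2 =
      ∑ i, fderiv ℝ f x (EuclideanSpace.single i 1) * fderiv ℝ f x (EuclideanSpace.single i 1) := by
  rw [EuclideanSpace.norm_sq_eq]
  simp [gradient_apply, sq]

theorem witten_eq (φ f : EuclideanSpace ℝ (Fin n) → ℝ) (x : EuclideanSpace ℝ (Fin n)) :
    witten n φ f x = ∑ i, hess n f x (EuclideanSpace.single i 1) (EuclideanSpace.single i 1) -
      ∑ i, fderiv ℝ φ x (EuclideanSpace.single i 1) * fderiv ℝ f x (EuclideanSpace.single i 1) := by
  rw [witten, lap, PiLp.inner_apply]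
  simp [gradient_apply, mul_comm]

theorem dirDeriv_prodMk_right {f : ℝ × EuclideanSpace ℝ (Fin n) → ℝ} {t : ℝ}
    {x : EuclideanSpace ℝ (Fin n)} (hf : DifferentiableAt ℝ f (t, x))
    (v : EuclideanSpace ℝ (Fin n)) :
    fderiv ℝ (fun y => f (t, y)) x v = dirDeriv ((0, v) : ℝ × _) f (t, x) := by
  have h : fderiv ℝ (fun y => f (t, y)) x = _ :=
    (hf.hasFDerivAt.comp x (hasFDerivAt_prodMk_right t x)).fderiv
  rw [h]
  simp [dirDeriv]

theorem deriv_prodMk_left {f : ℝ × EuclideanSpace ℝ (Fin n) → ℝ} {t : ℝ}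
    {x : EuclideanSpace ℝ (Fin n)} (hf : DifferentiableAt ℝ f (t, x)) :
    deriv (fun s => f (s, x)) t = dirDeriv (timeVec n) f (t, x) := by
  have h := (hf.hasFDerivAt.comp t (hasFDerivAt_prodMk_left t x)).hasDerivAt.deriv
  refine Eq.trans (by rfl) (h.trans ?_)
  simp [dirDeriv, timeVec]

theorem dirDeriv_comp_snd {f : EuclideanSpace ℝ (Fin n) → ℝ}
    {q : ℝ × EuclideanSpace ℝ (Fin n)} (hf : DifferentiableAt ℝ f q.2)
    (V : ℝ × EuclideanSpace ℝ (Fin n)) :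
    dirDeriv V (fun q : ℝ × EuclideanSpace ℝ (Fin n) => f q.2) q = fderiv ℝ f q.2 V.2 := by
  have h : fderiv ℝ (fun q : ℝ × EuclideanSpace ℝ (Fin n) => f q.2) q = _ :=
    (hf.hasFDerivAt.comp q hasFDerivAt_snd).fderiv
  rw [dirDeriv, h]
  simp

theorem hess_toLp {φ : EuclideanSpace ℝ (Fin n) → ℝ} (hφ : ContDiff ℝ ∞ φ)
    (x : EuclideanSpace ℝ (Fin n)) (v : Fin n → ℝ) :
    hess n φ x (WithLp.toLp 2 v) (WithLp.toLp 2 v) = ∑ i, ∑ j, v i * v j *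
      hess n φ x (EuclideanSpace.single i 1) (EuclideanSpace.single j 1) := by
  have h2 : DifferentiableAt ℝ (fderiv ℝ φ) x :=
    (hφ.contDiffAt.fderiv_right (m := ∞) (by simp)).differentiableAt (by decide)
  have key (v w) : hess n φ x v w = fderiv ℝ (fderiv ℝ φ) x w v := by
    have : fderiv ℝ (fun q => fderiv ℝ φ q v) x = _ :=
      (h2.hasFDerivAt.clm_apply (hasFDerivAt_const v x)).fderiv
    rw [hess, this]
    simp
  have hv : WithLp.toLp 2 v = ∑ i, v i • EuclideanSpace.single i (1 : ℝ) := by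
    ext k
    simp [Pi.single_apply]
  simp only [key, hv, map_sum, map_smul, sum_apply,
    smul_apply, smul_eq_mul, Finset.mul_sum]
  exact Finset.sum_congr rfl fun i _ => Finset.sum_congr rfl fun j _ => by ring

theorem contDiffOn_slice_fderiv {T : ℝ} (hT : 0 < T) {f : ℝ × EuclideanSpace ℝ (Fin n) → ℝ}
    (hf : ContDiffOn ℝ ∞ f {p | p.1 ∈ Set.Icc 0 T}) (v : EuclideanSpace ℝ (Fin n)) :
    ContDiffOn ℝ ∞ (fun p : ℝ × EuclideanSpace ℝ (Fin n) => fderiv ℝ (fun y => f (p.1, y)) p.2 v)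
      {p | p.1 ∈ Set.Icc 0 T} := by
  have hS : UniqueDiffOn ℝ {p : ℝ × EuclideanSpace ℝ (Fin n) | p.1 ∈ Set.Icc 0 T} := by
    have := (uniqueDiffOn_Icc hT).prod (uniqueDiffOn_univ (𝕜 := ℝ) (E := EuclideanSpace ℝ (Fin n)))
    rwa [Set.prod_univ] at this
  refine ((hf.fderivWithin hS (m := ∞) (by simp)).clm_apply
    (contDiffOn_const (c := ((0, v) : ℝ × EuclideanSpace ℝ (Fin n))))).congr fun p hp => ?_
  obtain ⟨t, x⟩ := p
  have h1 := ((hf.differentiableOn (by decide)) (t, x) hp).hasFDerivWithinAt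
  have h2 := h1.comp (s := Set.univ) (f := fun y => (t, y)) x
    (hasFDerivAt_prodMk_right t x).hasFDerivWithinAt fun y _ => hp
  have h3 : fderiv ℝ (fun y => f (t, y)) x = _ := (hasFDerivWithinAt_univ.1 h2).fderiv
  simp only [h3]
  simp

end Translation

section GradientBound

theorem sq_deriv_le_of_nonneg {g g' g'' : ℝ → ℝ} {M : ℝ} (hM : 0 < M)
    (hg : ∀ r, HasDerivAt g (g' r) r) (hg' : ∀ r, HasDerivAt g' (g'' r) r)
    (hbd : ∀ r, g'' r ≤ M) (hnn : ∀ r, 0 ≤ g r) : g' 0 ^ 2 ≤ 2 * M * g 0 := by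
  set k : ℝ → ℝ := fun r => M / 2 * r ^ 2 + g' 0 * r - g r with hk
  have hk1 (r) : HasDerivAt k (M * r + g' 0 - g' r) r := by
    refine ((((hasDerivAt_pow 2 r).const_mul (M / 2)).add
      ((hasDerivAt_id r).const_mul (g' 0))).sub (hg r)).congr_deriv ?_
    simp
    ring
  have hk2 (r) : HasDerivAt (fun r => M * r + g' 0 - g' r) (M - g'' r) r := by
    refine ((((hasDerivAt_id r).const_mul M).add_const (g' 0)).sub (hg' r)).congr_deriv ?_
    simp
  have hmono : Monotone fun r => M * r + g' 0 - g' r := by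
    refine monotone_of_deriv_nonneg (fun r => (hk2 r).differentiableAt) fun r => ?_
    rw [(hk2 r).deriv]
    linarith [hbd r]
  have hkc : Continuous k := continuous_iff_continuousAt.2 fun r => (hk1 r).continuousAt
  have hmin (r) : k 0 ≤ k r := by
    rcases le_total 0 r with h | h
    · refine monotoneOn_of_deriv_nonneg (convex_Ici 0) hkc.continuousOn
        (fun y _ => (hk1 y).differentiableAt.differentiableWithinAt) (fun y hy => ?_)
        (Set.mem_Ici.2 le_rfl) h h
      rw [interior_Ici] at hy
      rw [(hk1 y).deriv]
      simpa using hmono (Set.mem_Ioi.1 hy).le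
    · refine antitoneOn_of_deriv_nonpos (convex_Iic 0) hkc.continuousOn
        (fun y _ => (hk1 y).differentiableAt.differentiableWithinAt) (fun y hy => ?_)
        h (Set.mem_Iic.2 le_rfl) h
      rw [interior_Iic] at hy
      rw [(hk1 y).deriv]
      simpa using hmono (Set.mem_Iio.1 hy).le
  have h1 := hmin (-(g' 0) / M)
  have h2 := hnn (-(g' 0) / M)
  simp only [hk] at h1
  have h3 : M / 2 * (-(g' 0) / M) ^ 2 + g' 0 * (-(g' 0) / M) = -(g' 0 ^ 2 / (2 * M)) := by
    field_simp
    ring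
  have h4 : g' 0 ^ 2 / (2 * M) ≤ g 0 := by
    norm_num at h1
    linarith
  rw [div_le_iff₀ (by positivity)] at h4
  linarith

theorem sq_fderiv_le_of_nonneg {E : Type*} [NormedAddCommGroup E] [NormedSpace ℝ E] {f : E → ℝ}
    {M : ℝ} (hM : 0 < M) (hf : ContDiff ℝ ∞ f) (hnn : ∀ x, 0 ≤ f x) (v : E)
    (hbd : ∀ x, dirDeriv v (dirDeriv v f) x ≤ M) (x : E) : dirDeriv v f x ^ 2 ≤ 2 * M * f x := by
  have := sq_deriv_le_of_nonneg hM (fun r => hasDerivAt_comp_line (p := x) v (hf.contDiffAt.diffAt))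
    (fun r => hasDerivAt_comp_line (p := x) v (hf.contDiffAt.dirDeriv v).diffAt)
    (fun r => hbd _) (fun r => hnn _)
  simpa using this

end GradientBound

section Assembly

variable {n : ℕ} {m K T : ℝ} {φ : EuclideanSpace ℝ (Fin n) → ℝ}
  {u : ℝ → EuclideanSpace ℝ (Fin n) → ℝ}

/-- The `i`-th component of `∇φ` as a function on space-time. -/
def drift (n : ℕ) (φ : EuclideanSpace ℝ (Fin n) → ℝ) (i : Fin n)
    (q : ℝ × EuclideanSpace ℝ (Fin n)) : ℝ := fderiv ℝ φ q.2 (EuclideanSpace.single i 1)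

theorem contDiff_fderiv_apply (hφ : ContDiff ℝ ∞ φ) (v : EuclideanSpace ℝ (Fin n)) :
    ContDiff ℝ ∞ fun y => fderiv ℝ φ y v :=
  (hφ.fderiv_right (m := ∞) (by simp)).clm_apply contDiff_const

theorem contDiff_drift (hφ : ContDiff ℝ ∞ φ) (i : Fin n) : ContDiff ℝ ∞ (drift n φ i) :=
  (contDiff_fderiv_apply hφ _).comp contDiff_snd

theorem dirDeriv_drift (hφ : ContDiff ℝ ∞ φ) (i : Fin n) (V q : ℝ × EuclideanSpace ℝ (Fin n)) :
    dirDeriv V (drift n φ i) q = hess n φ q.2 (EuclideanSpace.single i 1) V.2 :=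
  dirDeriv_comp_snd (f := fun y => fderiv ℝ φ y (EuclideanSpace.single i 1))
    (contDiff_fderiv_apply hφ _).contDiffAt.diffAt V

theorem drift_cd (hφ : ContDiff ℝ ∞ φ) (hCD : CDcond n φ m K) (q : ℝ × EuclideanSpace ℝ (Fin n))
    (v : Fin n → ℝ) : -K * ∑ i, v i * v i ≤
      ∑ i, ∑ j, v i * v j * dirDeriv (spaceVec n j) (drift n φ i) q
        - (∑ i, drift n φ i q * v i) ^ 2 / (m - n) := by
  have h := hCD q.2 (WithLp.toLp 2 v)
  rw [hess_toLp hφ, EuclideanSpace.norm_sq_eq, PiLp.inner_apply] at h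
  simp only [dirDeriv_drift hφ, spaceVec, drift]
  simpa [gradient_apply, mul_comm, sq] using h

theorem abs_drift_le {C : ℝ} (hC : ∀ x, ‖gradient φ x‖ ≤ C) (i : Fin n)
    (q : ℝ × EuclideanSpace ℝ (Fin n)) : |drift n φ i q| ≤ C := by
  rw [drift, ← inner_gradient_left]
  refine (abs_real_inner_le_norm _ _).trans ?_
  simpa using hC q.2

theorem hess_eq_dirDeriv {F : ℝ × EuclideanSpace ℝ (Fin n) → ℝ} {t : ℝ}
    (hF : ∀ x, ContDiffAt ℝ ∞ F (t, x)) (x v w : EuclideanSpace ℝ (Fin n)) :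
    hess n (fun y => F (t, y)) x v w =
      dirDeriv ((0, w) : ℝ × _) (dirDeriv ((0, v) : ℝ × _) F) (t, x) := by
  have h (y) := dirDeriv_prodMk_right (hF y).diffAt v
  simp only [hess, h]
  exact dirDeriv_prodMk_right ((hF x).dirDeriv _).diffAt w

theorem witten_eq_dirDeriv {F : ℝ × EuclideanSpace ℝ (Fin n) → ℝ} {t : ℝ}
    (hF : ∀ x, ContDiffAt ℝ ∞ F (t, x)) (x : EuclideanSpace ℝ (Fin n)) :
    witten n φ (fun y => F (t, y)) x =
      ∑ i, dirDeriv (spaceVec n i) (dirDeriv (spaceVec n i) F) (t, x)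
        - ∑ i, drift n φ i (t, x) * dirDeriv (spaceVec n i) F (t, x) := by
  simp only [witten_eq, hess_eq_dirDeriv hF, dirDeriv_prodMk_right (hF x).diffAt]
  rfl

theorem gradSq_eq_norm_gradient_sq {F : ℝ × EuclideanSpace ℝ (Fin n) → ℝ} {t : ℝ}
    {x : EuclideanSpace ℝ (Fin n)} (hF : ContDiffAt ℝ ∞ F (t, x)) :
    gradSq (spaceVec n) F (t, x) = ‖gradient (fun y => F (t, y)) x‖ ^ 2 := by
  simp only [norm_gradient_sq, dirDeriv_prodMk_right hF.diffAt]
  rfl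

/-- A nonnegative function with bounded Hessian has `|∇f|²` bounded by a multiple of `f`. -/
theorem norm_gradient_sq_le {f : EuclideanSpace ℝ (Fin n) → ℝ} {C : ℝ} (hf : ContDiff ℝ ∞ f)
    (hnn : ∀ x, 0 ≤ f x) (hC : ∀ x, hessNormSq n f x ≤ C) (x : EuclideanSpace ℝ (Fin n)) :
    ‖gradient f x‖ ^ 2 ≤ n * (2 * (C + 1)) * f x := by
  have hC0 : 0 ≤ C :=
    le_trans (Finset.sum_nonneg fun i _ => Finset.sum_nonneg fun j _ => sq_nonneg _) (hC x)
  rw [norm_gradient_sq]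
  have h (i : Fin n) : fderiv ℝ f x (EuclideanSpace.single i 1) *
      fderiv ℝ f x (EuclideanSpace.single i 1) ≤ 2 * (C + 1) * f x := by
    rw [← sq]
    refine sq_fderiv_le_of_nonneg (by linarith) hf hnn _ (fun y => ?_) x
    have h1 : hess n f y (EuclideanSpace.single i 1) (EuclideanSpace.single i 1) ^ 2 ≤ C :=
      calc _ ≤ ∑ j, hess n f y (EuclideanSpace.single i 1) (EuclideanSpace.single j 1) ^ 2 :=
            Finset.single_le_sum (f := fun j => hess n f y (EuclideanSpace.single i 1)
              (EuclideanSpace.single j 1) ^ 2) (fun j _ => sq_nonneg _) (Finset.mem_univ i)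
        _ ≤ hessNormSq n f y :=
            Finset.single_le_sum (f := fun i => ∑ j, hess n f y (EuclideanSpace.single i 1)
              (EuclideanSpace.single j 1) ^ 2)
              (fun i _ => Finset.sum_nonneg fun j _ => sq_nonneg _) (Finset.mem_univ i)
        _ ≤ C := hC y
    change hess n f y (EuclideanSpace.single i 1) (EuclideanSpace.single i 1) ≤ C + 1
    nlinarith
  calc _ ≤ ∑ _i : Fin n, 2 * (C + 1) * f x := Finset.sum_le_sum fun i _ => h i
    _ = _ := by simp; ring

/-- Hamilton's estimate at interior times, in a form free of division by the time factor. -/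
theorem hamilton_estimate_interior (hn : 1 ≤ n) (hm : (n : ℝ) < m) (hK : 0 < K)
    (hφ : ContDiff ℝ ∞ φ) (hCD : CDcond n φ m K) {B : ℝ} (hB : ∀ x, ‖gradient φ x‖ ≤ B)
    {F : ℝ × EuclideanSpace ℝ (Fin n) → ℝ} {C A : ℝ}
    (hF : ∀ q, q.1 ∈ Set.Ioo 0 T → ContDiffAt ℝ ∞ F q)
    (hpos : ∀ q, q.1 ∈ Set.Ioo 0 T → 0 < F q) (hA : ∀ q, q.1 ∈ Set.Ioo 0 T → F q ≤ A)
    (hheat : ∀ q, q.1 ∈ Set.Ioo 0 T →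
      dirDeriv (timeVec n) F q = witten n φ (fun y => F (q.1, y)) q.2)
    (hC : ∀ q, q.1 ∈ Set.Ioo 0 T →
      |dirDeriv (timeVec n) F q| ≤ C ∧ hessNormSq n (fun y => F (q.1, y)) q.2 ≤ C)
    {t : ℝ} (ht : t ∈ Set.Ioo 0 T) (x : EuclideanSpace ℝ (Fin n)) :
    hamiltonQuantity n m K 0 (Real.log A) F (t, x) ≤ 0 := by
  have hm0 : 0 < m := lt_of_le_of_lt (Nat.cast_nonneg n) hm
  have hheat0 (q : ℝ × EuclideanSpace ℝ (Fin n)) (hq : q.1 ∈ Set.Ioo 0 T) :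
      heatOp (timeVec n) (spaceVec n) (drift n φ) F q = 0 := by
    rw [heatOp, hheat q hq, witten_eq_dirDeriv fun y => hF (q.1, y) hq]
    ring
  have hopen : IsOpen {q : ℝ × EuclideanSpace ℝ (Fin n) | q.1 ∈ Set.Ioo 0 T} :=
    isOpen_Ioo.preimage continuous_fst
  have hgrad (q : ℝ × EuclideanSpace ℝ (Fin n)) (hq : q.1 ∈ Set.Ioo 0 T) :
      gradSq (spaceVec n) F q * (F q)⁻¹ ≤ n * (2 * (C + 1)) := by
    rw [← div_eq_mul_inv, div_le_iff₀ (hpos q hq)]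
    have hslice : ContDiff ℝ ∞ fun y => F (q.1, y) := contDiff_iff_contDiffAt.2 fun y =>
      (hF (q.1, y) hq).comp y (contDiffAt_const.prodMk contDiffAt_id)
    have := norm_gradient_sq_le hslice (fun y => (hpos (q.1, y) hq).le)
      (fun y => (hC (q.1, y) hq).2) q.2
    rwa [← gradSq_eq_norm_gradient_sq (hF q hq)] at this
  have hlog (q : ℝ × EuclideanSpace ℝ (Fin n)) (hq : q.1 ∈ Set.Ioo 0 T) :
      Real.log (F q) ≤ Real.log A := Real.log_le_log (hpos q hq) (hA q hq)
  have hrest (q : ℝ × EuclideanSpace ℝ (Fin n)) (hq : q.1 ∈ Set.Ioo 0 T) :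
      0 ≤ (m + 4 * Real.log A) * F q - 4 * (F q * Real.log (F q)) := by
    have h1 := hpos q hq
    nlinarith [mul_nonneg h1.le (sub_nonneg.2 (hlog q hq)), mul_pos hm0 h1]
  have hstart (s : ℝ) (hs : s ∈ Set.Ioo 0 t) :
      hamiltonQuantity n m K s (Real.log A) F (t, x) ≤ 0 := by
    have hsub (q : ℝ × EuclideanSpace ℝ (Fin n)) (hq : q.1 ∈ Set.Icc s t) :
        q.1 ∈ Set.Ioo 0 T := ⟨hs.1.trans_le hq.1, hq.2.trans_lt ht.2⟩
    refine le_zero_of_heatOp_nonpos (a := drift n φ) (abs_drift_le hB)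
      (f := hamiltonQuantity n m K s (Real.log A) F) (s := s) (t := t)
      (M := 1 / K * (|C| + |n * (2 * (C + 1))|))
      (fun q hq => contDiffAt_hamiltonQuantity (hF q (hsub q hq)) (hpos q (hsub q hq)))
      (fun q hq => ?_) (fun y => ?_) (fun q hq hQ => ?_) (t, x) ⟨hs.2.le, le_rfl⟩
    · have hq' := hsub q hq
      have h1 : 0 ≤ (1 - Real.exp (-K * (q.1 - s))) / K := by
        refine div_nonneg (sub_nonneg.2 (Real.exp_le_one_iff.2 ?_)) hK.le
        nlinarith [hq.1]
      have h2 : (1 - Real.exp (-K * (q.1 - s))) / K ≤ 1 / K := by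
        gcongr
        linarith [Real.exp_pos (-K * (q.1 - s))]
      have h3 : dirDeriv (timeVec n) F q + gradSq (spaceVec n) F q * (F q)⁻¹ ≤
          |C| + |n * (2 * (C + 1))| :=
        add_le_add (((le_abs_self _).trans (hC q hq').1).trans (le_abs_self _))
          ((hgrad q hq').trans (le_abs_self _))
      have h4 := hrest q hq'
      unfold hamiltonQuantity
      have h5 := mul_le_mul_of_nonneg_left h3 h1
      have h6 := mul_le_mul_of_nonneg_right h2
        (by positivity : 0 ≤ |C| + |n * (2 * (C + 1))|)
      linarith
    · have := hrest (s, y) (hsub (s, y) ⟨le_rfl, hs.2.le⟩)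
      simp only [hamiltonQuantity, sub_self, mul_zero, Real.exp_zero, zero_div, zero_mul]
      linarith
    · have hq' := hsub q ⟨hq.1.le, hq.2⟩
      refine heatOp_hamiltonQuantity_nonpos hK hn hm (drift_cd hφ hCD q)
        (fun i => (contDiff_drift hφ i).contDiffAt) (fun i => ?_) (hF q hq') ?_ (hpos q hq')
        hq.1.le (hlog q hq') hQ
      · rw [dirDeriv_drift hφ]
        simp [timeVec, hess]
      · filter_upwards [hopen.mem_nhds hq'] with y hy
        exact hheat0 y hy
  have hcont : Continuous fun s => hamiltonQuantity n m K s (Real.log A) F (t, x) := by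
    unfold hamiltonQuantity
    fun_prop
  refine le_of_tendsto (hcont.continuousWithinAt (s := Set.Ioi 0) (x := 0)) ?_
  filter_upwards [Ioo_mem_nhdsGT ht.1] with s hs
  exact hstart s hs

end Assembly

/-- **Hamilton's estimate** for bounded positive solutions of the heat equation of the
Witten Laplacian on `ℝⁿ` under the `CD(−K, m)` condition (Euclidean case of Theorem 2.3). -/
theorem hamilton_estimate_witten
    (n : ℕ) (hn : 1 ≤ n) (m K T : ℝ) (hm : (n : ℝ) < m) (hK : 0 < K) (hT : 0 < T)
    (φ : EuclideanSpace ℝ (Fin n) → ℝ) (hφ : ContDiff ℝ (⊤ : ℕ∞) φ)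
    (hCD : CDcond n φ m K)
    (hgradφ : ∃ C, ∀ x, ‖gradient φ x‖ ≤ C)
    (hhessφ : ∃ C, ∀ x v w, |hess n φ x v w| ≤ C * ‖v‖ * ‖w‖)
    (u : ℝ → EuclideanSpace ℝ (Fin n) → ℝ)
    (hu : ContDiffOn ℝ (⊤ : ℕ∞) (fun p : ℝ × EuclideanSpace ℝ (Fin n) => u p.1 p.2)
      {p : ℝ × EuclideanSpace ℝ (Fin n) | p.1 ∈ Set.Icc 0 T})
    (hpos : ∀ t ∈ Set.Icc (0 : ℝ) T, ∀ x, 0 < u t x)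
    (hheat : ∀ t ∈ Set.Icc (0 : ℝ) T, ∀ x, deriv (fun s => u s x) t = witten n φ (u t) x)
    (hbd : ∃ C, ∀ t ∈ Set.Icc (0 : ℝ) T, ∀ x,
      |u t x| ≤ C ∧ |deriv (fun s => u s x) t| ≤ C ∧
        ‖gradient (u t) x‖ ≤ C ∧ hessNormSq n (u t) x ≤ C)
    (A : ℝ)
    (hA : IsLUB {a : ℝ | ∃ t ∈ Set.Icc (0 : ℝ) T, ∃ x, a = u t x} A) :
    ∀ t ∈ Set.Ioc (0 : ℝ) T, ∀ x,
      deriv (fun s => u s x) t / u t x + ‖gradient (u t) x‖ ^ 2 / (u t x) ^ 2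
        ≤ (K / (1 - Real.exp (-K * t))) * (m + 4 * Real.log (A / u t x)) := by
  obtain ⟨B, hB⟩ := hgradφ
  obtain ⟨C, hC⟩ := hbd
  set F : ℝ × EuclideanSpace ℝ (Fin n) → ℝ := fun p => u p.1 p.2 with hFdef
  have hIcc {r : ℝ} (hr : r ∈ Set.Ioo 0 T) : r ∈ Set.Icc 0 T := ⟨hr.1.le, hr.2.le⟩
  have hF (q : ℝ × EuclideanSpace ℝ (Fin n)) (hq : q.1 ∈ Set.Ioo 0 T) : ContDiffAt ℝ ∞ F q :=
    hu.contDiffAt (Filter.mem_of_superset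
      ((isOpen_Ioo.preimage continuous_fst).mem_nhds hq) fun y hy => hIcc hy)
  have htime (q : ℝ × EuclideanSpace ℝ (Fin n)) (hq : q.1 ∈ Set.Ioo 0 T) :
      deriv (fun s => u s q.2) q.1 = dirDeriv (timeVec n) F q := deriv_prodMk_left (hF q hq).diffAt
  have hAle {r : ℝ} (hr : r ∈ Set.Icc 0 T) (y) : u r y ≤ A := hA.1 ⟨r, hr, y, rfl⟩
  have hint (t : ℝ) (ht : t ∈ Set.Ioo 0 T) (x) :
      (1 - Real.exp (-K * t)) / K * (witten n φ (u t) x * u t x + ‖gradient (u t) x‖ ^ 2) ≤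
        (m + 4 * (Real.log A - Real.log (u t x))) * u t x ^ 2 := by
    have h := hamilton_estimate_interior (T := T) (C := C) (A := A) hn hm hK hφ hCD hB hF
      (fun q hq => hpos q.1 (hIcc hq) q.2) (fun q hq => hAle (hIcc hq) q.2)
      (fun q hq => by rw [← htime q hq]; exact hheat q.1 (hIcc hq) q.2)
      (fun q hq => by
        rw [← htime q hq]
        exact ⟨(hC q.1 (hIcc hq) q.2).2.1, (hC q.1 (hIcc hq) q.2).2.2.2⟩) ht x
    have hp := hpos t (hIcc ht) x
    rw [hamiltonQuantity, ← htime (t, x) ht, gradSq_eq_norm_gradient_sq (hF (t, x) ht),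
      hheat t (hIcc ht) x] at h
    simp only [hFdef, sub_zero] at h
    have h2 := mul_le_mul_of_nonneg_right h hp.le
    have h3 : ‖gradient (u t) x‖ ^ 2 * (u t x)⁻¹ * u t x = ‖gradient (u t) x‖ ^ 2 := by
      field_simp
    linear_combination h2 - (1 - Real.exp (-K * t)) / K * h3
  have hline (x : EuclideanSpace ℝ (Fin n)) : ContinuousOn (fun r : ℝ => (r, x)) (Set.Icc 0 T) := by
    fun_prop
  have hcont1 (x v : EuclideanSpace ℝ (Fin n)) :
      ContinuousOn (fun r => fderiv ℝ (u r) x v) (Set.Icc 0 T) :=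
    (contDiffOn_slice_fderiv hT hu v).continuousOn.comp (hline x) fun r hr => hr
  have hcont2 (x v w : EuclideanSpace ℝ (Fin n)) :
      ContinuousOn (fun r => hess n (u r) x v w) (Set.Icc 0 T) :=
    (contDiffOn_slice_fderiv hT (contDiffOn_slice_fderiv hT hu v) w).continuousOn.comp
      (hline x) fun r hr => hr
  have hcontu (x : EuclideanSpace ℝ (Fin n)) : ContinuousOn (fun r => u r x) (Set.Icc 0 T) :=
    hu.continuousOn.comp (hline x) fun r hr => hr
  have hall (t : ℝ) (ht : t ∈ Set.Ioc 0 T) (x) :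
      (1 - Real.exp (-K * t)) / K * (witten n φ (u t) x * u t x + ‖gradient (u t) x‖ ^ 2) ≤
        (m + 4 * (Real.log A - Real.log (u t x))) * u t x ^ 2 := by
    have hclos : t ∈ closure (Set.Ioo 0 T) := by
      rw [closure_Ioo hT.ne]
      exact ⟨ht.1.le, ht.2⟩
    refine ContinuousWithinAt.closure_le (s := Set.Ioo 0 T)
      (f := fun t => (1 - Real.exp (-K * t)) / K *
        (witten n φ (u t) x * u t x + ‖gradient (u t) x‖ ^ 2))
      (g := fun t => (m + 4 * (Real.log A - Real.log (u t x))) * u t x ^ 2) hclos ?_ ?_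
      fun r hr => hint r hr x
    · refine ContinuousOn.continuousWithinAt (s := Set.Icc 0 T) ?_ ⟨ht.1.le, ht.2⟩ |>.mono
        Set.Ioo_subset_Icc_self
      simp only [witten_eq, norm_gradient_sq]
      fun_prop
    · refine ContinuousOn.continuousWithinAt (s := Set.Icc 0 T) ?_ ⟨ht.1.le, ht.2⟩ |>.mono
        Set.Ioo_subset_Icc_self
      have hlog := (hcontu x).log fun r hr => (hpos r hr x).ne'
      fun_prop
  intro t ht x
  have ht' : t ∈ Set.Icc 0 T := ⟨ht.1.le, ht.2⟩
  have hp := hpos t ht' x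
  have hexp : 0 < 1 - Real.exp (-K * t) := by
    have : Real.exp (-K * t) < 1 := by
      rw [← Real.exp_zero]
      exact Real.exp_lt_exp.2 (by nlinarith [ht.1])
    linarith
  have h := hall t ht x
  rw [hheat t ht' x, Real.log_div (hp.trans_le (hAle ht' x)).ne' hp.ne']
  have h1 : witten n φ (u t) x / u t x + ‖gradient (u t) x‖ ^ 2 / u t x ^ 2 =
      (witten n φ (u t) x * u t x + ‖gradient (u t) x‖ ^ 2) / u t x ^ 2 := by
    field_simp
  rw [h1, div_le_iff₀ (by positivity)]
  have h2 := mul_le_mul_of_nonneg_left h (div_pos hK hexp).le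
  have h3 : K / (1 - Real.exp (-K * t)) * ((1 - Real.exp (-K * t)) / K) = 1 := by
    rw [div_mul_div_cancel₀ hexp.ne', div_self hK.ne']
  rw [← mul_assoc, h3, one_mul] at h2
  linarith
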